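/- Let 0 < p, q < ∞ and let U_c(S_p, S_q) denote the set of continuous functions f on the unit circle 𝕋 such that f(U) − f(V) ∈ S_q whenever U and V are commuting unitary operators on a separable Hilbert space with U − V ∈ S_p. Then: if p < q, U_c(S_p, S_q) equals the Hölder class Λ_{p/q}; if p = q, U_c(S_p, S_q) equals the class Lip of Lipschitz functions on 𝕋; and if p > q, U_c(S_p, S_q) contains only the constant functions. -/

import Mathlib

open scoped BigOperators
noncomputable section

/-- The `j`-th singular value of a bounded operator `T` on a Hilbert space:
`s_j(T) = inf {‖T - R‖ : rank R ≤ j}`. -/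
def sVal {H : Type} [NormedAddCommGroup H] [InnerProductSpace ℂ H] [CompleteSpace H]
    (T : H →L[ℂ] H) (j : ℕ) : ℝ :=
  sInf {c : ℝ | ∃ R : H →L[ℂ] H, LinearMap.rank (R : H →ₗ[ℂ] H) ≤ (j : Cardinal) ∧ c = ‖T - R‖}

/-- Membership in the Schatten–von Neumann class `S_p`. -/
def MemSchatten {H : Type} [NormedAddCommGroup H] [InnerProductSpace ℂ H] [CompleteSpace H]
    (p : ℝ) (T : H →L[ℂ] H) : Prop :=
  Summable fun j : ℕ => sVal T j ^ p

/-- The Schatten–von Neumann norm `‖T‖_{S_p} = (∑_{j ≥ 0} s_j(T)^p)^{1/p}`. -/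
def schNorm {H : Type} [NormedAddCommGroup H] [InnerProductSpace ℂ H] [CompleteSpace H]
    (p : ℝ) (T : H →L[ℂ] H) : ℝ :=
  (∑' j : ℕ, sVal T j ^ p) ^ (1 / p)

/-- `f` satisfies the Hölder condition of order `α` on the unit circle with constant `C`. -/
def HoelderCircleWith (C α : ℝ) (f : ℂ → ℂ) : Prop :=
  ∀ ζ τ : ℂ, ‖ζ‖ = 1 → ‖τ‖ = 1 → ‖f ζ - f τ‖ ≤ C * ‖ζ - τ‖ ^ α

/-- The Hölder norm on the circle, `‖f‖_{Λ_α} = sup_{ζ ≠ τ} |f(ζ) - f(τ)|/|ζ - τ|^α`, realized as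
the least admissible Hölder constant. -/
def hoelderCircleNorm (α : ℝ) (f : ℂ → ℂ) : ℝ :=
  sInf {C : ℝ | 0 ≤ C ∧ HoelderCircleWith C α f}

/-- Membership in the Hölder class `Λ_α` on the unit circle. -/
def MemHoelderCircle (α : ℝ) (f : ℂ → ℂ) : Prop :=
  ∃ C : ℝ, 0 ≤ C ∧ HoelderCircleWith C α f

/-- The class `U_c(S_p, S_q)`: continuous functions `f` on the unit circle such that
`f(U) - f(V) ∈ S_q` whenever `U, V` are commuting unitary operators on a separable Hilbert space
with `U - V ∈ S_p`. -/
def MemUc (p q : ℝ) (f : ℂ → ℂ) : Prop :=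
  ContinuousOn f (Metric.sphere (0 : ℂ) 1) ∧
    ∀ (H : Type) [NormedAddCommGroup H] [InnerProductSpace ℂ H] [CompleteSpace H]
      [TopologicalSpace.SeparableSpace H],
      ∀ U V : H →L[ℂ] H, U ∈ unitary (H →L[ℂ] H) → V ∈ unitary (H →L[ℂ] H) →
        Commute U V → MemSchatten p (U - V) → MemSchatten q (cfc f U - cfc f V)

section SingularValues

variable {H : Type} [NormedAddCommGroup H] [InnerProductSpace ℂ H]

lemma bddBelow_sVal_set (T : H →L[ℂ] H) (j : ℕ) : BddBelow {c : ℝ | ∃ R : H →L[ℂ] H,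
    LinearMap.rank (R : H →ₗ[ℂ] H) ≤ (j : Cardinal) ∧ c = ‖T - R‖} :=
  ⟨0, by rintro c ⟨R, -, rfl⟩; exact norm_nonneg _⟩

lemma nonempty_sVal_set (T : H →L[ℂ] H) (j : ℕ) : {c : ℝ | ∃ R : H →L[ℂ] H,
    LinearMap.rank (R : H →ₗ[ℂ] H) ≤ (j : Cardinal) ∧ c = ‖T - R‖}.Nonempty :=
  ⟨‖T - 0‖, 0, by simp [LinearMap.rank_zero], rfl⟩

lemma ContinuousLinearMap.rank_mul_le_left (S T : H →L[ℂ] H) :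
    LinearMap.rank ((S * T : H →L[ℂ] H) : H →ₗ[ℂ] H) ≤ LinearMap.rank (S : H →ₗ[ℂ] H) :=
  LinearMap.rank_comp_le_left (T : H →ₗ[ℂ] H) (S : H →ₗ[ℂ] H)

variable [CompleteSpace H]

lemma sVal_nonneg (T : H →L[ℂ] H) (j : ℕ) : 0 ≤ sVal T j :=
  le_csInf (nonempty_sVal_set T j) (by rintro c ⟨R, -, rfl⟩; exact norm_nonneg _)

lemma sVal_le {T R : H →L[ℂ] H} {j : ℕ}
    (hR : LinearMap.rank (R : H →ₗ[ℂ] H) ≤ (j : Cardinal)) : sVal T j ≤ ‖T - R‖ :=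
  csInf_le (bddBelow_sVal_set T j) ⟨R, hR, rfl⟩

lemma exists_rank_le_of_sVal_lt {T : H →L[ℂ] H} {j : ℕ} {ε : ℝ} (h : sVal T j < ε) :
    ∃ R : H →L[ℂ] H, LinearMap.rank (R : H →ₗ[ℂ] H) ≤ (j : Cardinal) ∧ ‖T - R‖ < ε := by
  obtain ⟨c, ⟨R, hR, rfl⟩, hc⟩ := exists_lt_of_csInf_lt (nonempty_sVal_set T j) h
  exact ⟨R, hR, hc⟩

/-- A subspace on which `T` is bounded below by `ε` has dimension at most `j`
as soon as `s_j(T) < ε`. -/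
lemma rank_le_of_sVal_lt {T : H →L[ℂ] H} {j : ℕ} {ε : ℝ} (h : sVal T j < ε)
    (W : Submodule ℂ H) (hW : ∀ x ∈ W, ε * ‖x‖ ≤ ‖T x‖) : Module.rank ℂ W ≤ (j : Cardinal) := by
  obtain ⟨R, hR, hTR⟩ := exists_rank_le_of_sVal_lt h
  refine le_trans ?_ hR
  let g : W →ₗ[ℂ] LinearMap.range (R : H →ₗ[ℂ] H) := (R : H →ₗ[ℂ] H).rangeRestrict.domRestrict W
  refine LinearMap.rank_le_of_injective g ((injective_iff_map_eq_zero g).2 fun x hx => ?_)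
  have hRx : R x = 0 := congrArg Subtype.val hx
  by_contra hne
  have hpos : 0 < ‖(x : H)‖ := norm_pos_iff.2 (by simpa using hne)
  have h1 := hW x x.2
  have h2 : ‖T x‖ ≤ ‖T - R‖ * ‖(x : H)‖ := by
    simpa [hRx] using (T - R).le_opNorm (x : H)
  nlinarith

/-- The range of `Φ` has dimension at most `j` if `T` has a left inverse of norm at most `ε⁻¹` on
this range and `s_j(T) < ε`. -/
lemma rank_le_of_mul_eq {T K Φ : H →L[ℂ] H} {j : ℕ} {ε : ℝ} (hε : 0 < ε) (h : sVal T j < ε)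
    (hK : ‖K‖ ≤ ε⁻¹) (hKT : K * T * Φ = Φ) :
    LinearMap.rank (Φ : H →ₗ[ℂ] H) ≤ (j : Cardinal) := by
  refine rank_le_of_sVal_lt h _ ?_
  rintro _ ⟨y, rfl⟩
  have h1 : K (T (Φ y)) = Φ y := congrArg (fun S : H →L[ℂ] H => S y) hKT
  have h2 : ‖Φ y‖ ≤ ε⁻¹ * ‖T (Φ y)‖ := by
    calc ‖Φ y‖ = ‖K (T (Φ y))‖ := by rw [h1]
      _ ≤ ‖K‖ * ‖T (Φ y)‖ := K.le_opNorm _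
      _ ≤ _ := by gcongr
  calc ε * ‖Φ y‖ ≤ ε * (ε⁻¹ * ‖T (Φ y)‖) := by gcongr
    _ = ‖T (Φ y)‖ := by field_simp

end SingularValues

section Calculus

variable {H : Type} [NormedAddCommGroup H] [InnerProductSpace ℂ H] [CompleteSpace H]
variable {X : Type*} [TopologicalSpace X] [CompactSpace X]

lemma sVal_map_le_of_lt (π : C(X, ℂ) →⋆ₐ[ℂ] (H →L[ℂ] H)) (n g : C(X, ℂ)) {C α : ℝ} (hC : 0 ≤ C)
    (hα : 0 < α) (hg : ∀ x, ‖g x‖ ≤ C * ‖n x‖ ^ α) {j : ℕ} {ε δ : ℝ} (hε : sVal (π n) j < ε)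
    (hδ : ε < δ) : sVal (π g) j ≤ C * δ ^ α := by
  have hε0 : 0 < ε := (sVal_nonneg _ _).trans_lt hε
  have hδ0 : 0 < δ := hε0.trans hδ
  let χ : C(X, ℂ) := ⟨fun x => ((max 0 (min 1 ((‖n x‖ - ε) / (δ - ε))) : ℝ) : ℂ), by fun_prop⟩
  let κ : C(X, ℂ) := ⟨fun x => star (n x) / ((max ‖n x‖ ε ^ 2 : ℝ) : ℂ), by
    refine Continuous.div (by fun_prop) (by fun_prop) fun x => ?_
    have : 0 < max ‖n x‖ ε := lt_max_of_lt_right hε0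
    exact_mod_cast (pow_pos this 2).ne'⟩
  have hκ : ‖κ‖ ≤ ε⁻¹ := by
    refine (ContinuousMap.norm_le _ (by positivity)).2 fun x => ?_
    have h0 : 0 < max ‖n x‖ ε := lt_max_of_lt_right hε0
    have : ‖κ x‖ = ‖n x‖ / max ‖n x‖ ε ^ 2 := by
      simp [κ, abs_of_pos h0]
    rw [this, div_le_iff₀ (by positivity), inv_mul_eq_div, le_div_iff₀ hε0, sq]
    exact mul_le_mul (le_max_left _ _) (le_max_right _ _) hε0.le h0.le
  have hκχ : κ * n * χ = χ := by
    ext x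
    rcases le_or_gt ‖n x‖ ε with hx | hx
    · have : χ x = 0 := by
        have : (‖n x‖ - ε) / (δ - ε) ≤ 0 :=
          div_nonpos_of_nonpos_of_nonneg (by linarith) (by linarith)
        simp [χ, min_eq_right (this.trans zero_le_one), this]
      simp [this]
    · have hne : n x ≠ 0 := norm_pos_iff.1 (hε0.trans hx)
      have : κ x * n x = 1 := by
        simp only [κ, ContinuousMap.coe_mk, max_eq_left hx.le]
        rw [div_mul_eq_mul_div, mul_comm, RCLike.star_def, Complex.mul_conj,
          Complex.normSq_eq_norm_sq, div_self]
        exact_mod_cast pow_ne_zero 2 (norm_ne_zero_iff.2 hne)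
      simp [this]
  have hrank : LinearMap.rank ((π (g * χ) : H →L[ℂ] H) : H →ₗ[ℂ] H) ≤ (j : Cardinal) := by
    rw [mul_comm, map_mul]
    refine (ContinuousLinearMap.rank_mul_le_left _ _).trans
      (rank_le_of_mul_eq (T := π n) (K := π κ) hε0 hε ?_ ?_)
    · exact (NonUnitalStarAlgHom.norm_apply_le π κ).trans hκ
    · rw [← map_mul, ← map_mul, hκχ]
  refine (sVal_le hrank).trans ?_
  rw [← map_sub]
  refine (NonUnitalStarAlgHom.norm_apply_le π _).trans
    ((ContinuousMap.norm_le _ (by positivity)).2 fun x => ?_)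
  have hχ : ‖1 - χ x‖ = 1 - max 0 (min 1 ((‖n x‖ - ε) / (δ - ε))) := by
    have h1 : max 0 (min 1 ((‖n x‖ - ε) / (δ - ε))) ≤ 1 := max_le zero_le_one (min_le_left _ _)
    simp only [χ, ContinuousMap.coe_mk]
    rw [← Complex.ofReal_one, ← Complex.ofReal_sub, Complex.norm_real, Real.norm_eq_abs,
      abs_of_nonneg (by linarith)]
  have hgx : (g - g * χ) x = g x * (1 - χ x) := by simp; ring
  rw [hgx, norm_mul, hχ]
  rcases le_or_gt δ ‖n x‖ with hx | hx
  · have : 1 ≤ (‖n x‖ - ε) / (δ - ε) := by rw [le_div_iff₀] <;> linarith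
    simp only [min_eq_left this, zero_le_one, max_eq_right, sub_self, mul_zero]
    positivity
  · calc _ ≤ ‖g x‖ * 1 := by
          gcongr
          linarith [le_max_left 0 (min 1 ((‖n x‖ - ε) / (δ - ε)))]
      _ ≤ C * ‖n x‖ ^ α := by simpa using hg x
      _ ≤ _ := by gcongr

lemma sVal_map_le (π : C(X, ℂ) →⋆ₐ[ℂ] (H →L[ℂ] H)) (n g : C(X, ℂ)) {C α : ℝ} (hC : 0 ≤ C)
    (hα : 0 < α) (hg : ∀ x, ‖g x‖ ≤ C * ‖n x‖ ^ α) (j : ℕ) :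
    sVal (π g) j ≤ C * sVal (π n) j ^ α := by
  have hcont : Filter.Tendsto (fun δ : ℝ => C * δ ^ α) (nhdsWithin (sVal (π n) j) (Set.Ioi (sVal (π n) j)))
     
      (nhds (C * sVal (π n) j ^ α)) :=
    (((Real.continuousAt_rpow_const _ _ (Or.inr hα.le)).const_mul C).tendsto).mono_left
      nhdsWithin_le_nhds
  refine ge_of_tendsto hcont ?_
  filter_upwards [self_mem_nhdsWithin] with δ hδ
  obtain ⟨ε, h1, h2⟩ := exists_between (show sVal (π n) j < δ from hδ)
  exact sVal_map_le_of_lt π n g hC hα hg h1 h2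

/-- Evaluation of the continuous functional calculus under a character. -/
lemma StarAlgHom.apply_cfc_eq {A : Type*} [CStarAlgebra A] (φ : A →⋆ₐ[ℂ] ℂ) (f : ℂ → ℂ) (a : A)
    [IsStarNormal a] (hf : ContinuousOn f (spectrum ℂ a)) : φ (cfc f a) = f (φ a) := by
  rw [StarAlgHom.map_cfc φ f a hf (by fun_prop)]
  simpa using cfc_algebraMap (A := ℂ) (φ a) f

/-- Two commuting unitaries lie in the image of a common algebra of continuous functions. -/
lemma exists_starAlgHom_of_commute.{u} {A : Type u} [CStarAlgebra A] {U V : A} (hU : U ∈ unitary A)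
    (hV : V ∈ unitary A) (hUV : Commute U V) :
    ∃ (X : Type u) (_ : TopologicalSpace X) (_ : CompactSpace X) (π : C(X, ℂ) →⋆ₐ[ℂ] A)
      (u v : C(X, ℂ)), u ∈ unitary C(X, ℂ) ∧ v ∈ unitary C(X, ℂ) ∧ π u = U ∧ π v = V := by
  let S := (StarAlgebra.adjoin ℂ {U, V}).topologicalClosure
  have hs : ∀ a ∈ ({U, V} : Set A), ∀ b ∈ ({U, V} : Set A), a * b = b * a := by
    rintro a (rfl | rfl) b (rfl | rfl)
    exacts [rfl, hUV.eq, hUV.eq.symm, rfl]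
  have hs' : ∀ a ∈ ({U, V} : Set A), ∀ b ∈ ({U, V} : Set A), a * star b = star b * a := by
    intro a ha b hb
    have hbu : b ∈ unitary A := by
      rcases hb with rfl | rfl
      exacts [hU, hV]
    have hab := hs a ha b hb
    calc a * star b = star b * b * a * star b := by rw [Unitary.star_mul_self_of_mem hbu, one_mul]
      _ = star b * (b * a) * star b := by noncomm_ring
      _ = star b * a * (b * star b) := by rw [← hab]; noncomm_ring
      _ = star b * a := by rw [Unitary.mul_star_self_of_mem hbu, mul_one]
  have hcomm : IsMulCommutative (StarAlgebra.adjoin ℂ {U, V}) :=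
    StarAlgebra.isMulCommutative_adjoin ℂ hs hs'
  let _ : CStarAlgebra S := StarSubalgebra.cstarAlgebra S
    (h_closed := StarSubalgebra.isClosed_topologicalClosure _)
  let _ : CommRing S := StarSubalgebra.commRingTopologicalClosure _
    fun x y => hcomm.is_comm.comm x y
  let _ : CommCStarAlgebra S := { (inferInstance : CStarAlgebra S) with mul_comm := mul_comm }
  let Γ := gelfandStarTransform S
  let π : C(WeakDual.characterSpace ℂ S, ℂ) →⋆ₐ[ℂ] A := S.subtype.comp (Γ.symm : _ →⋆ₐ[ℂ] S)
  have hUS : U ∈ S := StarSubalgebra.le_topologicalClosure _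
    (StarAlgebra.subset_adjoin ℂ _ (by simp))
  have hVS : V ∈ S := StarSubalgebra.le_topologicalClosure _
    (StarAlgebra.subset_adjoin ℂ _ (by simp))
  have hmem : ∀ a : S, (a : A) ∈ unitary A → Γ a ∈ unitary C(WeakDual.characterSpace ℂ S, ℂ) := by
    intro a ha
    refine Unitary.map_mem Γ (Unitary.mem_iff.2 ⟨Subtype.ext ?_, Subtype.ext ?_⟩)
    · exact Unitary.star_mul_self_of_mem ha
    · exact Unitary.mul_star_self_of_mem ha
  have hπ : ∀ a : S, π (Γ a) = a := fun a => by simp [π]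
  exact ⟨_, inferInstance, inferInstance, π, Γ ⟨U, hUS⟩, Γ ⟨V, hVS⟩, hmem _ hU, hmem _ hV,
    hπ _, hπ _⟩

end Calculus

section Sufficiency

lemma MemHoelderCircle.continuousOn {α : ℝ} (hα : 0 < α) {f : ℂ → ℂ} (hf : MemHoelderCircle α f) :
    ContinuousOn f (Metric.sphere (0 : ℂ) 1) := by
  obtain ⟨C, hC, h⟩ := hf
  intro a ha
  refine tendsto_iff_norm_sub_tendsto_zero.2 (squeeze_zero' (g := fun x => C * ‖x - a‖ ^ α)
    (Filter.Eventually.of_forall fun x => norm_nonneg _) ?_ ?_)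
  · filter_upwards [self_mem_nhdsWithin] with x hx
    exact h x a (by simpa using hx) (by simpa using ha)
  · have : ContinuousAt (fun x : ℂ => C * ‖x - a‖ ^ α) a :=
      ((continuousAt_id.sub continuousAt_const).norm.rpow_const (Or.inr hα.le)).const_mul C
    simpa [ContinuousAt, Real.zero_rpow hα.ne'] using this.tendsto.mono_left nhdsWithin_le_nhds

lemma ContinuousMap.cfc_apply_eq {X : Type*} [TopologicalSpace X] [CompactSpace X] (f : ℂ → ℂ)
    (u : C(X, ℂ)) (hf : ContinuousOn f (spectrum ℂ u)) (x : X) : cfc f u x = f (u x) :=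
  StarAlgHom.apply_cfc_eq (ContinuousMap.evalStarAlgHom ℂ ℂ x) f u hf

lemma norm_eq_one_of_mem_unitary {A : Type*} [CStarAlgebra A] (φ : A →⋆ₐ[ℂ] ℂ) {u : A}
    (hu : u ∈ unitary A) : ‖φ u‖ = 1 := by
  simpa using CStarRing.norm_of_mem_unitary (Unitary.map_mem φ hu)

lemma MemHoelderCircle.memUc {p q : ℝ} (hp : 0 < p) (hq : 0 < q) {f : ℂ → ℂ}
    (hf : MemHoelderCircle (p / q) f) : MemUc p q f := by
  have hcont := hf.continuousOn (div_pos hp hq)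
  refine ⟨hcont, ?_⟩
  obtain ⟨C, hC, h⟩ := hf
  intro H _ _ _ _ U V hU hV hUV hS
  obtain ⟨X, _, _, π, u, v, hu, hv, rfl, rfl⟩ := exists_starAlgHom_of_commute hU hV hUV
  have hfu := hcont.mono (spectrum.subset_circle_of_unitary (𝕜 := ℂ) hu)
  have hfv := hcont.mono (spectrum.subset_circle_of_unitary (𝕜 := ℂ) hv)
  have key (j : ℕ) : sVal (cfc f (π u) - cfc f (π v)) j ≤ C * sVal (π u - π v) j ^ (p / q) := by
    have hπ : Continuous π := AddMonoidHomClass.continuous_of_bound π 1 fun a => by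
      simpa using NonUnitalStarAlgHom.norm_apply_le π a
    have hnu : IsStarNormal (π u) := isStarNormal_of_mem_unitary hU
    have hnv : IsStarNormal (π v) := isStarNormal_of_mem_unitary hV
    rw [← StarAlgHom.map_cfc π f u hfu hπ, ← StarAlgHom.map_cfc π f v hfv hπ, ← map_sub, ← map_sub]
    refine sVal_map_le π _ _ hC (div_pos hp hq) (fun x => ?_) j
    rw [ContinuousMap.sub_apply, ContinuousMap.cfc_apply_eq f u hfu,
      ContinuousMap.cfc_apply_eq f v hfv]
    exact h _ _ (norm_eq_one_of_mem_unitary (ContinuousMap.evalStarAlgHom ℂ ℂ x) hu)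
      (norm_eq_one_of_mem_unitary (ContinuousMap.evalStarAlgHom ℂ ℂ x) hv)
  refine Summable.of_nonneg_of_le (fun j => Real.rpow_nonneg (sVal_nonneg _ _) _) (fun j => ?_)
    (Summable.mul_left (C ^ q) hS)
  calc _ ≤ (C * sVal (π u - π v) j ^ (p / q)) ^ q :=
        Real.rpow_le_rpow (sVal_nonneg _ _) (key j) hq.le
    _ = _ := by
        rw [Real.mul_rpow hC (Real.rpow_nonneg (sVal_nonneg _ _) _),
          ← Real.rpow_mul (sVal_nonneg _ _), div_mul_cancel₀ _ hq.ne']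

end Sufficiency

section Diagonal

open scoped lp ENNReal BoundedContinuousFunction

/-- The standard Hilbert basis of `ℓ²`. -/
def stdBasis (ι : Type) : HilbertBasis ι ℂ ℓ²(ι, ℂ) := ⟨LinearIsometryEquiv.refl ℂ _⟩

lemma stdBasis_apply {ι : Type} [DecidableEq ι] (i j : ι) : stdBasis ι i j = if j = i then 1 else 0 := by
  have : stdBasis ι i = lp.single 2 i (1 : ℂ) := (stdBasis ι).repr_self i
  rw [this, lp.single_apply]
  simp [Pi.single_apply]

lemma separableSpace_l2 (ι : Type) [Countable ι] : TopologicalSpace.SeparableSpace ℓ²(ι, ℂ) := by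
  have h := (Set.countable_range (stdBasis ι)).isSeparable.span (R := ℂ)
  rw [← TopologicalSpace.isSeparable_univ_iff]
  have h2 := h.closure
  rwa [← Submodule.topologicalClosure_coe, (stdBasis ι).dense_span, Submodule.top_coe] at h2

variable {ι : Type} [TopologicalSpace ι]

lemma norm_bcf_mul_le (d : ι →ᵇ ℂ) (x : ℓ²(ι, ℂ)) (i : ι) :
    ‖d i * x i‖ ≤ ‖((‖d‖ : ℂ) • x) i‖ := by
  rw [lp.coeFn_smul, Pi.smul_apply, norm_smul, norm_mul, Complex.norm_real, norm_norm]
  exact mul_le_mul_of_nonneg_right (d.norm_coe_le_norm i) (norm_nonneg (x i))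

/-- Multiplication by a bounded function on `ℓ²`. -/
def diagCLM (d : ι →ᵇ ℂ) : ℓ²(ι, ℂ) →L[ℂ] ℓ²(ι, ℂ) :=
  LinearMap.mkContinuous
    { toFun := fun x => ⟨fun i => d i * x i,
        (lp.memℓp ((‖d‖ : ℂ) • x)).mono' (norm_bcf_mul_le d x)⟩
      map_add' := fun x y => Subtype.ext (funext fun i => mul_add (d i) (x i) (y i))
      map_smul' := fun c x => by ext i; simp [mul_left_comm] } ‖d‖ fun x =>
    (lp.norm_mono two_ne_zero (norm_bcf_mul_le d x)).trans_eq (by rw [norm_smul]; simp)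

@[simp]
lemma diagCLM_apply (d : ι →ᵇ ℂ) (x : ℓ²(ι, ℂ)) (i : ι) : diagCLM d x i = d i * x i := rfl

/-- Bounded functions act on `ℓ²` by a star homomorphism. -/
def diagHom : (ι →ᵇ ℂ) →⋆ₐ[ℂ] (ℓ²(ι, ℂ) →L[ℂ] ℓ²(ι, ℂ)) where
  toFun := diagCLM
  map_one' := by ext x i; simp
  map_mul' a b := by ext x i; simp [mul_assoc]
  map_zero' := by ext x i; simp
  map_add' a b := by ext x i; simp [add_mul]
  commutes' c := by ext x i; simp [Algebra.algebraMap_eq_smul_one]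
  map_star' a := by
    rw [ContinuousLinearMap.star_eq_adjoint, ContinuousLinearMap.eq_adjoint_iff]
    intro x y
    simp only [lp.inner_eq_tsum]
    refine tsum_congr fun i => ?_
    simp; ring

@[simp]
lemma diagHom_apply (d : ι →ᵇ ℂ) (x : ℓ²(ι, ℂ)) (i : ι) : diagHom d x i = d i * x i := rfl

/-- Evaluation at a point as a character of the algebra of bounded functions. -/
def evalHom (i : ι) : (ι →ᵇ ℂ) →⋆ₐ[ℂ] ℂ where
  toFun d := d i
  map_one' := rfl
  map_mul' _ _ := rfl
  map_zero' := rfl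
  map_add' _ _ := rfl
  commutes' c := by simp [Algebra.algebraMap_eq_smul_one]
  map_star' _ := rfl

lemma norm_diagHom_le (d : ι →ᵇ ℂ) {c : ℝ} (hc : 0 ≤ c) (h : ∀ i, ‖d i‖ ≤ c) :
    ‖diagHom d‖ ≤ c :=
  (NonUnitalStarAlgHom.norm_apply_le diagHom d).trans ((BoundedContinuousFunction.norm_le hc).2 h)

variable [DiscreteTopology ι]

/-- The indicator of a finite set as a bounded function. -/
def indicatorBCF (F : Finset ι) : ι →ᵇ ℂ :=
  BoundedContinuousFunction.ofNormedAddCommGroupDiscrete ((F : Set ι).indicator 1) 1 fun i => by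
    by_cases h : i ∈ F <;> simp [h]

lemma indicatorBCF_apply [DecidableEq ι] (F : Finset ι) (i : ι) :
    indicatorBCF F i = if i ∈ F then 1 else 0 := by
  simp [indicatorBCF, Set.indicator_apply]

lemma range_diagHom_indicatorBCF (F : Finset ι) :
    LinearMap.range
      ((diagHom (indicatorBCF F) : ℓ²(ι, ℂ) →L[ℂ] ℓ²(ι, ℂ)) : ℓ²(ι, ℂ) →ₗ[ℂ] ℓ²(ι, ℂ)) =
    Submodule.span ℂ (Set.range fun i : F => stdBasis ι i) := by
  classical
  apply le_antisymm
  · rintro _ ⟨x, rfl⟩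
    have : diagHom (indicatorBCF F) x = ∑ i ∈ F, x i • stdBasis ι i := by
      ext j
      have hsum : (∑ i ∈ F, x i • stdBasis ι i) j = ∑ i ∈ F, x i * stdBasis ι i j :=
        map_sum (lp.evalCLM ℂ (fun _ : ι => ℂ) 2 j) (fun i => x i • stdBasis ι i) F
      rw [hsum]
      simp [stdBasis_apply, indicatorBCF_apply]
    rw [ContinuousLinearMap.coe_coe, this]
    exact Submodule.sum_mem _ fun i hi =>
      Submodule.smul_mem _ _ (Submodule.subset_span ⟨⟨i, hi⟩, rfl⟩)
  · rw [Submodule.span_le]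
    rintro _ ⟨i, rfl⟩
    refine ⟨stdBasis ι i, ?_⟩
    ext j
    by_cases h : j = i <;> simp [stdBasis_apply, indicatorBCF_apply, h]

lemma rank_diagHom_indicatorBCF (F : Finset ι) :
    LinearMap.rank
      ((diagHom (indicatorBCF F) : ℓ²(ι, ℂ) →L[ℂ] ℓ²(ι, ℂ)) : ℓ²(ι, ℂ) →ₗ[ℂ] ℓ²(ι, ℂ)) =
    (F.card : Cardinal) := by
  have hli : LinearIndependent ℂ fun i : F => stdBasis ι i :=
    ((stdBasis ι).orthonormal.comp _ Subtype.val_injective).linearIndependent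
  rw [LinearMap.rank, range_diagHom_indicatorBCF, rank_span hli, Cardinal.mk_range_eq _ hli.injective]
  simp

/-- Outside any `j` points there is an entry comparable with the `j`-th singular value. -/
lemma exists_sVal_le_two_mul [Infinite ι] (d : ι →ᵇ ℂ) (F : Finset ι) :
    ∃ i ∉ F, sVal (diagHom d) F.card ≤ 2 * ‖d i‖ := by
  classical
  rcases (sVal_nonneg (diagHom d) F.card).eq_or_lt with h0 | hpos
  · obtain ⟨i, hi⟩ := Infinite.exists_notMem_finset F
    exact ⟨i, hi, by rw [← h0]; positivity⟩
  by_contra! hcon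
  have hrank : LinearMap.rank ((diagHom (indicatorBCF F * d) : ℓ²(ι, ℂ) →L[ℂ] ℓ²(ι, ℂ)) :
      ℓ²(ι, ℂ) →ₗ[ℂ] ℓ²(ι, ℂ)) ≤ (F.card : Cardinal) := by
    rw [map_mul]
    exact (ContinuousLinearMap.rank_mul_le_left _ _).trans (rank_diagHom_indicatorBCF F).le
  have h1 := sVal_le (T := diagHom d) hrank
  rw [← map_sub] at h1
  have h2 : ‖diagHom (d - indicatorBCF F * d)‖ ≤ sVal (diagHom d) F.card / 2 := by
    refine norm_diagHom_le _ (by positivity) fun i => ?_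
    by_cases hi : i ∈ F
    · simpa [indicatorBCF_apply, hi] using (half_pos hpos).le
    · have := hcon i hi
      simp only [BoundedContinuousFunction.coe_sub, BoundedContinuousFunction.coe_mul,
        Pi.sub_apply, Pi.mul_apply, indicatorBCF_apply, hi, if_false, zero_mul, sub_zero]
      linarith
  linarith

lemma memSchatten_diagHom [Infinite ι] {p : ℝ} (hp : 0 < p) (d : ι →ᵇ ℂ)
    (h : Summable fun i => ‖d i‖ ^ p) : MemSchatten p (diagHom d) := by
  classical
  have key (m : ℕ) : ∃ F : Finset ι, F.card = m ∧
      ∑ j ∈ Finset.range m, sVal (diagHom d) j ^ p ≤ ∑ i ∈ F, (2 * ‖d i‖) ^ p := by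
    induction m with
    | zero => exact ⟨∅, by simp⟩
    | succ m ih =>
      obtain ⟨F, rfl, hF⟩ := ih
      obtain ⟨i, hi, hle⟩ := exists_sVal_le_two_mul d F
      refine ⟨insert i F, Finset.card_insert_of_notMem hi, ?_⟩
      rw [Finset.sum_range_succ, Finset.sum_insert hi, add_comm]
      exact add_le_add (Real.rpow_le_rpow (sVal_nonneg _ _) hle hp.le) hF
  have h2 : Summable fun i => (2 * ‖d i‖) ^ p := by
    simpa only [Real.mul_rpow zero_le_two (norm_nonneg _)] using h.mul_left (2 ^ p)
  refine summable_of_sum_range_le (c := ∑' i, (2 * ‖d i‖) ^ p)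
    (fun j => Real.rpow_nonneg (sVal_nonneg _ _) _) fun m => ?_
  obtain ⟨F, -, hF⟩ := key m
  exact hF.trans (h2.sum_le_tsum F fun i _ => by positivity)

lemma le_sVal_diagHom (d : ι →ᵇ ℂ) (F : Finset ι) {j : ℕ} (hj : j < F.card) {ε : ℝ} (hε : 0 < ε)
    (h : ∀ i ∈ F, ε ≤ ‖d i‖) : ε ≤ sVal (diagHom d) j := by
  classical
  by_contra! hlt
  let κ : ι →ᵇ ℂ := BoundedContinuousFunction.ofNormedAddCommGroupDiscrete
    (fun i => if i ∈ F then (d i)⁻¹ else 0) ε⁻¹ fun i => by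
      split_ifs with hi
      · rw [norm_inv]
        exact inv_anti₀ hε (h i hi)
      · simpa using hε.le
  have hκ (i : ι) : κ i = if i ∈ F then (d i)⁻¹ else 0 := rfl
  have hr := rank_le_of_mul_eq (T := diagHom d) (K := diagHom κ)
    (Φ := diagHom (indicatorBCF F)) hε hlt
    (norm_diagHom_le _ (by positivity) fun i => by
      rw [hκ]
      split_ifs with hi
      · rw [norm_inv]
        exact inv_anti₀ hε (h i hi)
      · simpa using hε.le) (by
      rw [← map_mul, ← map_mul]
      congr 1
      ext i
      by_cases hi : i ∈ F
      · have : d i ≠ 0 := norm_pos_iff.1 (hε.trans_le (h i hi))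
        simp [indicatorBCF_apply, hκ, hi, this]
      · simp [indicatorBCF_apply, hi])
  rw [rank_diagHom_indicatorBCF, Nat.cast_le] at hr
  omega

lemma summable_of_memSchatten_diagHom {q : ℝ} (hq : 0 < q) (d : ι →ᵇ ℂ)
    (h : MemSchatten q (diagHom d)) : Summable fun i => ‖d i‖ ^ q := by
  classical
  have key (m : ℕ) : ∀ F : Finset ι, F.card = m →
      ∑ i ∈ F, ‖d i‖ ^ q ≤ ∑ j ∈ Finset.range m, sVal (diagHom d) j ^ q := by
    induction m with
    | zero => intro F hF; simp [Finset.card_eq_zero.1 hF]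
    | succ m ih =>
      intro F hF
      obtain ⟨i, hi, hmin⟩ := F.exists_min_image (fun i => ‖d i‖)
        (Finset.card_pos.1 (by omega))
      rw [Finset.sum_range_succ, ← Finset.sum_erase_add F _ hi]
      refine add_le_add (ih _ (by rw [Finset.card_erase_of_mem hi, hF]; rfl)) ?_
      rcases (norm_nonneg (d i)).eq_or_lt with h0 | hpos
      · rw [← h0, Real.zero_rpow hq.ne']
        exact Real.rpow_nonneg (sVal_nonneg _ _) _
      · exact Real.rpow_le_rpow hpos.le (le_sVal_diagHom d F (by omega) hpos hmin) hq.le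
  refine summable_of_sum_le (c := ∑' j, sVal (diagHom d) j ^ q) (fun i => by positivity) fun F => ?_
  exact (key _ F rfl).trans
    (Summable.sum_le_tsum _ (fun j _ => Real.rpow_nonneg (sVal_nonneg _ _) _) h)

end Diagonal

section Necessity

open scoped BoundedContinuousFunction

/-- A unimodular function on a discrete space as a bounded function. -/
def circleBCF {ι : Type} [TopologicalSpace ι] [DiscreteTopology ι] (ζ : ι → ℂ)
    (hζ : ∀ i, ‖ζ i‖ = 1) : ι →ᵇ ℂ :=
  BoundedContinuousFunction.ofNormedAddCommGroupDiscrete ζ 1 fun i => (hζ i).le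

lemma circleBCF_mem_unitary {ι : Type} [TopologicalSpace ι] [DiscreteTopology ι] (ζ : ι → ℂ)
    (hζ : ∀ i, ‖ζ i‖ = 1) : circleBCF ζ hζ ∈ unitary (ι →ᵇ ℂ) := by
  have h (i : ι) : star (ζ i) * ζ i = 1 := by
    rw [RCLike.star_def, Complex.conj_mul', hζ]; simp
  refine Unitary.mem_iff.2 ⟨?_, ?_⟩
  · ext i
    exact h i
  · ext i
    exact (mul_comm _ _).trans (h i)

/-- Testing `MemUc` on diagonal operators. -/
lemma MemUc.summable {p q : ℝ} (hp : 0 < p) (hq : 0 < q) {f : ℂ → ℂ} (hf : MemUc p q f)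
    {ι : Type} [TopologicalSpace ι] [DiscreteTopology ι] [Infinite ι] [Countable ι]
    {ζ τ : ι → ℂ} (hζ : ∀ i, ‖ζ i‖ = 1) (hτ : ∀ i, ‖τ i‖ = 1)
    (h : Summable fun i => ‖ζ i - τ i‖ ^ p) : Summable fun i => ‖f (ζ i) - f (τ i)‖ ^ q := by
  obtain ⟨hcont, hUc⟩ := hf
  have := separableSpace_l2 ι
  have hπ : Continuous (diagHom (ι := ι)) := AddMonoidHomClass.continuous_of_bound diagHom 1
    fun a => by simpa using NonUnitalStarAlgHom.norm_apply_le diagHom a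
  have hcfc (σ : ι → ℂ) (hσ : ∀ i, ‖σ i‖ = 1) :
      cfc f (diagHom (circleBCF σ hσ)) = diagHom (cfc f (circleBCF σ hσ)) ∧
        ∀ i, cfc f (circleBCF σ hσ) i = f (σ i) := by
    have hu := circleBCF_mem_unitary σ hσ
    have hfu := hcont.mono (spectrum.subset_circle_of_unitary (𝕜 := ℂ) hu)
    have hn := isStarNormal_of_mem_unitary hu
    have hn' := isStarNormal_of_mem_unitary (Unitary.map_mem (diagHom (ι := ι)) hu)
    exact ⟨(StarAlgHom.map_cfc diagHom f _ hfu hπ).symm,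
      fun i => StarAlgHom.apply_cfc_eq (evalHom i) f _ hfu⟩
  have key := hUc _ (diagHom (circleBCF ζ hζ)) (diagHom (circleBCF τ hτ))
    (Unitary.map_mem diagHom (circleBCF_mem_unitary ζ hζ))
    (Unitary.map_mem diagHom (circleBCF_mem_unitary τ hτ))
    ((Commute.all _ _).map diagHom)
    (by rw [← map_sub]; exact memSchatten_diagHom hp _ h)
  rw [(hcfc ζ hζ).1, (hcfc τ hτ).1, ← map_sub] at key
  simpa [(hcfc ζ hζ).2, (hcfc τ hτ).2] using summable_of_memSchatten_diagHom hq _ key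

lemma exists_bound_of_continuousOn_circle {f : ℂ → ℂ}
    (hf : ContinuousOn f (Metric.sphere (0 : ℂ) 1)) :
    ∃ B : ℝ, 0 ≤ B ∧ ∀ ζ τ : ℂ, ‖ζ‖ = 1 → ‖τ‖ = 1 → ‖f ζ - f τ‖ ≤ B := by
  obtain ⟨M, hM⟩ := (isCompact_sphere (0 : ℂ) 1).exists_bound_of_continuousOn hf
  have h (ζ : ℂ) (hζ : ‖ζ‖ = 1) : ‖f ζ‖ ≤ M := hM ζ (by simpa using hζ)
  refine ⟨M + M, ?_, fun ζ τ hζ hτ => (norm_sub_le _ _).trans (add_le_add (h ζ hζ) (h τ hτ))⟩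
  have := (norm_nonneg _).trans (h 1 (by simp))
  linarith

lemma MemUc.memHoelderCircle {p q : ℝ} (hp : 0 < p) (hq : 0 < q) {f : ℂ → ℂ} (hf : MemUc p q f) :
    MemHoelderCircle (p / q) f := by
  by_contra hcon
  have hex (k : ℕ) : ∃ ζ τ : ℂ, ‖ζ‖ = 1 ∧ ‖τ‖ = 1 ∧
      4 ^ k * ‖ζ - τ‖ ^ p < ‖f ζ - f τ‖ ^ q := by
    have hk : ¬ HoelderCircleWith (((4 : ℝ) ^ k) ^ (1 / q)) (p / q) f :=
      fun h => hcon ⟨_, by positivity, h⟩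
    simp only [HoelderCircleWith, not_forall, not_le] at hk
    obtain ⟨ζ, τ, hζ, hτ, hlt⟩ := hk
    refine ⟨ζ, τ, hζ, hτ, ?_⟩
    have := Real.rpow_lt_rpow (by positivity) hlt hq
    rwa [Real.mul_rpow (by positivity) (by positivity), ← Real.rpow_mul (by positivity),
      ← Real.rpow_mul (by positivity), one_div_mul_cancel hq.ne', Real.rpow_one,
      div_mul_cancel₀ _ hq.ne'] at this
  choose ζ τ hζ hτ hlt using hex
  obtain ⟨B, hB0, hB⟩ := exists_bound_of_continuousOn_circle hf.1
  have hδ (k : ℕ) : 0 < ‖ζ k - τ k‖ ^ p := by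
    refine Real.rpow_pos_of_pos (norm_pos_iff.2 (sub_ne_zero.2 fun h => ?_)) p
    have := hlt k
    simp [h, Real.zero_rpow hp.ne', Real.zero_rpow hq.ne'] at this
  have hδB (k : ℕ) : ‖ζ k - τ k‖ ^ p ≤ B ^ q * (1 / 4) ^ k := by
    have h1 := (hlt k).le.trans
      (Real.rpow_le_rpow (norm_nonneg _) (hB _ _ (hζ k) (hτ k)) hq.le)
    rw [one_div, inv_pow, ← div_eq_mul_inv, le_div_iff₀ (by positivity)]
    linarith
  -- the pair `(ζ k, τ k)` is repeated so often that its weight is comparable with `2⁻ᵏ`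
  let N (k : ℕ) : ℕ := ⌈((2 : ℝ) ^ k * ‖ζ k - τ k‖ ^ p)⁻¹⌉₊
  have hN1 (k : ℕ) : ((2 : ℝ) ^ k * ‖ζ k - τ k‖ ^ p)⁻¹ ≤ N k := Nat.le_ceil _
  have hN2 (k : ℕ) : (N k : ℝ) ≤ ((2 : ℝ) ^ k * ‖ζ k - τ k‖ ^ p)⁻¹ + 1 :=
    (Nat.ceil_lt_add_one (by have := hδ k; positivity)).le
  have hNpos (k : ℕ) : 0 < N k := Nat.ceil_pos.2 (by have := hδ k; positivity)
  have : Infinite (Σ k, Fin (N k)) :=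
    Infinite.of_injective (fun k : ℕ => (⟨k, 0, hNpos k⟩ : Σ k, Fin (N k)))
      fun a b h => congrArg Sigma.fst h
  have hsum : Summable fun i : Σ k, Fin (N k) => ‖ζ i.1 - τ i.1‖ ^ p := by
    refine (summable_sigma_of_nonneg fun i => (hδ i.1).le).2
      ⟨fun k => (hasSum_fintype _).summable, ?_⟩
    refine Summable.of_nonneg_of_le (fun k => tsum_nonneg fun _ => (hδ k).le) (fun k => ?_)
      ((summable_geometric_of_lt_one (r := (1 / 2 : ℝ)) (by norm_num) (by norm_num)).add
        ((summable_geometric_of_lt_one (r := (1 / 4 : ℝ)) (by norm_num) (by norm_num)).mul_left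
          (B ^ q)))
    simp only [tsum_fintype, Finset.sum_const, Finset.card_univ, Fintype.card_fin, nsmul_eq_mul]
    calc (N k : ℝ) * ‖ζ k - τ k‖ ^ p
        ≤ (((2 : ℝ) ^ k * ‖ζ k - τ k‖ ^ p)⁻¹ + 1) * ‖ζ k - τ k‖ ^ p :=
          mul_le_mul_of_nonneg_right (hN2 k) (hδ k).le
      _ = (1 / 2) ^ k + ‖ζ k - τ k‖ ^ p := by
          have := (hδ k).ne'
          rw [one_div, inv_pow]
          field_simp
      _ ≤ _ := by gcongr; exact hδB k
  have hsum' := hf.summable hp hq (fun i : Σ k, Fin (N k) => hζ i.1) (fun i => hτ i.1) hsum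
  have hs := ((summable_sigma_of_nonneg fun i => by positivity).1 hsum').2
  have hge (k : ℕ) : 1 ≤ ∑' _ : Fin (N k), ‖f (ζ k) - f (τ k)‖ ^ q := by
    rw [tsum_fintype, Finset.sum_const, Finset.card_univ, Fintype.card_fin, nsmul_eq_mul]
    have := hδ k
    calc (1 : ℝ) ≤ 2 ^ k := one_le_pow₀ one_le_two
      _ = ((2 : ℝ) ^ k * ‖ζ k - τ k‖ ^ p)⁻¹ * (4 ^ k * ‖ζ k - τ k‖ ^ p) := by
          rw [show (4 : ℝ) = 2 * 2 by norm_num, mul_pow]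
          field_simp
      _ ≤ N k * ‖f (ζ k) - f (τ k)‖ ^ q :=
          mul_le_mul (hN1 k) (hlt k).le (by positivity) (by positivity)
  exact absurd (ge_of_tendsto' hs.tendsto_atTop_zero hge) (by norm_num)

/-- Hölder functions of order greater than one on the circle are constant. -/
lemma MemHoelderCircle.eq_of_one_lt {α : ℝ} (hα : 1 < α) {f : ℂ → ℂ} (hf : MemHoelderCircle α f)
    {ζ τ : ℂ} (hζ : ‖ζ‖ = 1) (hτ : ‖τ‖ = 1) : f ζ = f τ := by
  obtain ⟨C, hC, h⟩ := hf
  let g : ℝ → ℂ := fun t => f (Complex.exp (t * Complex.I))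
  have hg (s t : ℝ) : ‖g s - g t‖ ≤ C * |s - t| ^ α := by
    refine (h _ _ (Complex.norm_exp_ofReal_mul_I s) (Complex.norm_exp_ofReal_mul_I t)).trans ?_
    have : ‖Complex.exp (s * Complex.I) - Complex.exp (t * Complex.I)‖ ≤ |s - t| := by
      have he : Complex.exp (s * Complex.I) - Complex.exp (t * Complex.I) =
          Complex.exp (t * Complex.I) * (Complex.exp (Complex.I * (s - t : ℝ)) - 1) := by
        rw [mul_sub, ← Complex.exp_add, mul_one]
        congr 2
        push_cast
        ring
      rw [he, norm_mul, Complex.norm_exp_ofReal_mul_I, one_mul]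
      exact Real.norm_exp_I_mul_ofReal_sub_one_le
    gcongr
  have hderiv (t : ℝ) : HasDerivAt g 0 t := by
    rw [hasDerivAt_iff_isLittleO]
    simp only [smul_zero, sub_zero]
    have hO : (fun s => g s - g t) =O[nhds t] fun s => |s - t| ^ α :=
      Asymptotics.IsBigO.of_bound C (Filter.Eventually.of_forall fun s => by
        simpa [abs_of_nonneg (Real.rpow_nonneg (abs_nonneg (s - t)) α)] using hg s t)
    refine hO.trans_isLittleO ?_
    have hlim : Filter.Tendsto (fun s : ℝ => |s - t| ^ (α - 1)) (nhds t) (nhds 0) := by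
      have : ContinuousAt (fun s : ℝ => |s - t| ^ (α - 1)) t :=
        (continuousAt_id.sub continuousAt_const).abs.rpow_const (Or.inr (by linarith))
      simpa [ContinuousAt, Real.zero_rpow (sub_pos.2 hα).ne'] using this
    have habs : (fun s : ℝ => |s - t|) =O[nhds t] fun s => s - t :=
      (Asymptotics.isBigO_refl (fun s : ℝ => s - t) _).norm_left
    refine (((Asymptotics.isLittleO_one_iff ℝ).2 hlim).mul_isBigO habs).congr (fun s => ?_)
      fun s => one_mul _
    rcases (abs_nonneg (s - t)).eq_or_lt with h0 | hpos
    · rw [← h0, mul_zero, Real.zero_rpow (by linarith)]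
    · rw [Real.rpow_sub_one hpos.ne', div_mul_cancel₀ _ hpos.ne']
  have hconst := is_const_of_deriv_eq_zero (fun t => (hderiv t).differentiableAt)
    (fun t => (hderiv t).deriv)
  have := hconst ζ.arg τ.arg
  simp only [g] at this
  have e (z : ℂ) (hz : ‖z‖ = 1) : Complex.exp (z.arg * Complex.I) = z := by
    simpa [hz] using Complex.norm_mul_exp_arg_mul_I z
  rwa [e ζ hζ, e τ hτ] at this

end Necessity

theorem stmt14 (p q : ℝ) (hp : 0 < p) (hq : 0 < q) :
    (p < q → ∀ f : ℂ → ℂ, MemUc p q f ↔ MemHoelderCircle (p / q) f) ∧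
    (p = q → ∀ f : ℂ → ℂ, MemUc p q f ↔ MemHoelderCircle 1 f) ∧
    (q < p → ∀ f : ℂ → ℂ, MemUc p q f ↔
      (ContinuousOn f (Metric.sphere (0 : ℂ) 1) ∧
        ∀ ζ τ : ℂ, ‖ζ‖ = 1 → ‖τ‖ = 1 → f ζ = f τ)) := by
  have key (f : ℂ → ℂ) : MemUc p q f ↔ MemHoelderCircle (p / q) f :=
    ⟨fun h => h.memHoelderCircle hp hq, fun h => h.memUc hp hq⟩
  refine ⟨fun _ => key, ?_, fun hqp f => ⟨fun h => ⟨h.1, fun ζ τ hζ hτ => ?_⟩, fun h => ?_⟩⟩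
  · rintro rfl f
    rw [key, div_self hp.ne']
  · exact ((key f).1 h).eq_of_one_lt ((one_lt_div hq).2 hqp) hζ hτ
  · exact (key f).2 ⟨0, le_rfl, fun ζ τ hζ hτ => by simp [h.2 ζ τ hζ hτ]⟩
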